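/- In the weight lattice of so(2r+1, ℂ) (type B_r) with Weyl group acting by signed permutations on ℝ^r and dominance meaning λ_1 ≥ ... ≥ λ_r ≥ 0, for a ≤ p < b ≤ r = p+q, the index of the weight ε_a - ε_b equals (a-1) + (p+q-b) + q, and the index of -ε_a + ε_b equals (b-(p+1)) + (p-a) + p - 1. -/

import Mathlib

noncomputable section

/-- The `i`-th standard basis vector of `ℝ^r`. -/
def eps (r : ℕ) (i : Fin r) : Fin r → ℝ := fun k => if k = i then 1 else 0

/-- Linear automorphisms of `ℝ^r`. -/
abbrev Aut (r : ℕ) := (Fin r → ℝ) ≃ₗ[ℝ] (Fin r → ℝ)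

/-- The automorphism permuting coordinates by `e` (i.e. `v ↦ v ∘ e`). -/
def permAut {r : ℕ} (e : Equiv.Perm (Fin r)) : Aut r :=
  LinearEquiv.funCongrLeft ℝ ℝ e

/-- The automorphism negating the `i`-th coordinate. -/
def flipAut {r : ℕ} (i : Fin r) : Aut r :=
  LinearEquiv.piCongrRight (fun k => if k = i then LinearEquiv.neg ℝ else LinearEquiv.refl ℝ ℝ)

/-- `ind`: minimal length of a word in the simple generators whose product moves `lam` into
the dominant cone (this is the minimal Coxeter length of `w ∈ W` with `w • lam` dominant). -/
def ind (r : ℕ) (isGen : Aut r → Prop) (dom : (Fin r → ℝ) → Prop) (lam : Fin r → ℝ) : ℕ :=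
  sInf { n | ∃ l : List (Aut r), (∀ g ∈ l, isGen g) ∧ l.length = n ∧ dom (l.prod lam) }

/-- Simple generators of the symmetric group `S_r` (type `A_{r-1}`): adjacent transpositions. -/
def isGenA (r : ℕ) (g : Aut r) : Prop :=
  ∃ i j : Fin r, (i : ℕ) + 1 = (j : ℕ) ∧ g = permAut (Equiv.swap i j)

/-- Type `A` dominance: weakly decreasing coordinates. -/
def domA (r : ℕ) (v : Fin r → ℝ) : Prop := ∀ i j : Fin r, i ≤ j → v j ≤ v i

/-- Simple generators of the hyperoctahedral group (Weyl group of type `B_r`/`C_r`):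
adjacent transpositions and the sign flip of the last coordinate. -/
def isGenBC (r : ℕ) (g : Aut r) : Prop :=
  (∃ i j : Fin r, (i : ℕ) + 1 = (j : ℕ) ∧ g = permAut (Equiv.swap i j)) ∨
  (∃ h : r - 1 < r, g = flipAut ⟨r - 1, h⟩)

/-- Type `B/C` dominance: `λ₁ ≥ ⋯ ≥ λ_r ≥ 0`. -/
def domBC (r : ℕ) (v : Fin r → ℝ) : Prop :=
  (∀ i j : Fin r, i ≤ j → v j ≤ v i) ∧ ∀ i, 0 ≤ v i

/-- Simple generators of the Weyl group of type `D_r`: adjacent transpositions and the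
reflection in `ε_{r-1} + ε_r` (swap the last two coordinates and negate both). -/
def isGenD (r : ℕ) (g : Aut r) : Prop :=
  (∃ i j : Fin r, (i : ℕ) + 1 = (j : ℕ) ∧ g = permAut (Equiv.swap i j)) ∨
  (∃ (h1 : r - 2 < r) (h2 : r - 1 < r),
    g = flipAut ⟨r - 2, h1⟩ * flipAut ⟨r - 1, h2⟩ *
      permAut (Equiv.swap ⟨r - 2, h1⟩ ⟨r - 1, h2⟩))

/-- Type `D` dominance: `λ₁ ≥ ⋯ ≥ λ_{r-1} ≥ |λ_r|`. -/
def domD (r : ℕ) (v : Fin r → ℝ) : Prop :=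
  (∀ i j : Fin r, i ≤ j → (j : ℕ) + 1 < r → v j ≤ v i) ∧
  (∀ i : Fin r, (i : ℕ) + 1 < r → ∀ h : r - 1 < r, |v ⟨r - 1, h⟩| ≤ v i)

/-- Simple generators of `W(B_p) × W(B_q)` acting on `ℝ^{p+q}`: adjacent transpositions
within each block, and the sign flips of the last coordinate of each block. -/
def isGenBB (p q : ℕ) (g : Aut (p + q)) : Prop :=
  (∃ i j : Fin (p + q), (i : ℕ) + 1 = (j : ℕ) ∧ ((j : ℕ) < p ∨ p ≤ (i : ℕ)) ∧
    g = permAut (Equiv.swap i j)) ∨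
  (∃ h : p - 1 < p + q, 1 ≤ p ∧ g = flipAut ⟨p - 1, h⟩) ∨
  (∃ h : p + q - 1 < p + q, 1 ≤ q ∧ g = flipAut ⟨p + q - 1, h⟩)

/-- Dominance for `W(B_p) × W(B_q)`: each block weakly decreasing and nonnegative. -/
def domBB (p q : ℕ) (v : Fin (p + q) → ℝ) : Prop :=
  (∀ i j : Fin (p + q), i ≤ j → (j : ℕ) < p → v j ≤ v i) ∧
  (∀ i j : Fin (p + q), i ≤ j → p ≤ (i : ℕ) → v j ≤ v i) ∧
  (∀ i, 0 ≤ v i)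

/-- Simple generators of `W(D_p) × W(B_q)` acting on `ℝ^{p+q}`. -/
def isGenDB (p q : ℕ) (g : Aut (p + q)) : Prop :=
  (∃ i j : Fin (p + q), (i : ℕ) + 1 = (j : ℕ) ∧ ((j : ℕ) < p ∨ p ≤ (i : ℕ)) ∧
    g = permAut (Equiv.swap i j)) ∨
  (∃ (h1 : p - 2 < p + q) (h2 : p - 1 < p + q), 2 ≤ p ∧
    g = flipAut ⟨p - 2, h1⟩ * flipAut ⟨p - 1, h2⟩ *
      permAut (Equiv.swap ⟨p - 2, h1⟩ ⟨p - 1, h2⟩)) ∨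
  (∃ h : p + q - 1 < p + q, 1 ≤ q ∧ g = flipAut ⟨p + q - 1, h⟩)

/-- Dominance for `W(D_p) × W(B_q)`: `v₁ ≥ ⋯ ≥ v_{p-1} ≥ |v_p|` on the first block and
`v_{p+1} ≥ ⋯ ≥ v_{p+q} ≥ 0` on the second. -/
def domDB (p q : ℕ) (v : Fin (p + q) → ℝ) : Prop :=
  (∀ i j : Fin (p + q), i ≤ j → (j : ℕ) + 1 < p → v j ≤ v i) ∧
  (∀ i : Fin (p + q), (i : ℕ) + 1 < p → ∀ h : p - 1 < p + q, |v ⟨p - 1, h⟩| ≤ v i) ∧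
  (∀ i j : Fin (p + q), i ≤ j → p ≤ (i : ℕ) → v j ≤ v i) ∧
  (∀ i : Fin (p + q), p ≤ (i : ℕ) → 0 ≤ v i)

/-- The sign attached to a Boolean. -/
def sg (s : Bool) : ℝ := if s then 1 else -1

/-- The vector `± ε_i ± ε_j`. -/
def vec {r : ℕ} (s : Bool) (i : Fin r) (t : Bool) (j : Fin r) : Fin r → ℝ :=
  fun k => if k = i then sg s else if k = j then sg t else 0

/-- The distance of `± ε_i ± ε_j` from the dominant chamber. -/
def pot (p q : ℕ) (s : Bool) (i : ℕ) (t : Bool) (j : ℕ) : ℕ :=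
  (if s then i else 2 * p - 2 - i) + (if t then j - p else p + 2 * q - 1 - j)

theorem sg_not (s : Bool) : sg (!s) = - sg s := by cases s <;> simp [sg]

theorem permAut_apply {r : ℕ} (e : Equiv.Perm (Fin r)) (v : Fin r → ℝ) (k : Fin r) :
    permAut e v k = v (e k) := rfl

theorem flipAut_apply {r : ℕ} (i : Fin r) (v : Fin r → ℝ) (k : Fin r) :
    flipAut i v k = if k = i then - v k else v k := by
  unfold flipAut
  by_cases h : k = i <;> simp [h]

theorem swap_vec {r : ℕ} (x y : Fin r) (s t : Bool) (i j : Fin r) :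
    permAut (Equiv.swap x y) (vec s i t j)
      = vec s (Equiv.swap x y i) t (Equiv.swap x y j) := by
  funext k
  rw [permAut_apply]
  simp only [vec]
  have h (m : Fin r) : Equiv.swap x y k = m ↔ k = Equiv.swap x y m := by
    rw [Equiv.swap_apply_eq_iff]
  simp only [h]

theorem flip_vec {r : ℕ} (x : Fin r) (s t : Bool) (i j : Fin r) (hij : i ≠ j) :
    flipAut x (vec s i t j)
      = vec (if i = x then !s else s) i (if j = x then !t else t) j := by
  funext k
  rw [flipAut_apply]
  simp only [vec]
  have h1 := sg_not s
  have h2 := sg_not t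
  split_ifs <;> simp_all

theorem gen_vec (p q : ℕ) (g : Aut (p + q)) (hg : isGenDB p q g) (s t : Bool)
    (i j : Fin (p + q)) (hi : (i : ℕ) < p) (hj : p ≤ (j : ℕ)) :
    ∃ (s' t' : Bool) (i' j' : Fin (p + q)), (i' : ℕ) < p ∧ p ≤ (j' : ℕ) ∧
      g (vec s i t j) = vec s' i' t' j' ∧ pot p q s i t j ≤ pot p q s' i' t' j' + 1 := by
  have hij : i ≠ j := by rintro rfl; omega
  have := j.2
  rcases hg with ⟨x, y, hxy, hb, rfl⟩ | ⟨h1, h2, hp, rfl⟩ | ⟨h, hq, rfl⟩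
  · refine ⟨s, t, _, _, ?_, ?_, swap_vec x y s t i j, ?_⟩
    · rw [Equiv.swap_apply_def]; split_ifs <;> simp_all <;> omega
    · rw [Equiv.swap_apply_def]; split_ifs <;> simp_all <;> omega
    · simp only [Equiv.swap_apply_def, pot]
      simp only [Fin.ext_iff]
      split_ifs <;> omega
  · have hj1 : j ≠ ⟨p - 2, h1⟩ := by intro h; simp [Fin.ext_iff] at h; omega
    have hj2 : j ≠ ⟨p - 1, h2⟩ := by intro h; simp [Fin.ext_iff] at h; omega
    have hne : Equiv.swap ⟨p - 2, h1⟩ ⟨p - 1, h2⟩ i ≠ j := by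
      rw [Equiv.swap_apply_def]; split_ifs
      · exact hj2.symm
      · exact hj1.symm
      · exact hij
    refine ⟨if i = ⟨p - 2, h1⟩ ∨ i = ⟨p - 1, h2⟩ then !s else s, t,
      Equiv.swap ⟨p - 2, h1⟩ ⟨p - 1, h2⟩ i, j, ?_, hj, ?_, ?_⟩
    · rw [Equiv.swap_apply_def]; split_ifs <;> simp_all <;> omega
    · rw [LinearEquiv.mul_apply, LinearEquiv.mul_apply, swap_vec,
        Equiv.swap_apply_of_ne_of_ne hj1 hj2, flip_vec _ _ _ _ _ hne, flip_vec _ _ _ _ _ hne]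
      congr 1
      · simp only [Equiv.swap_apply_def, Fin.ext_iff]
        split_ifs <;> simp_all <;> omega
      · simp [hj1, hj2]
    · simp only [Equiv.swap_apply_def, pot]
      by_cases c1 : i = ⟨p - 2, h1⟩
      · have c3 : (i : ℕ) = p - 2 := by rw [c1]
        rw [if_pos (Or.inl c1), if_pos c1]
        cases s <;> simp <;> omega
      · by_cases c2 : i = ⟨p - 1, h2⟩
        · have c3 : (i : ℕ) = p - 1 := by rw [c2]
          rw [if_pos (Or.inr c2), if_neg c1, if_pos c2]
          cases s <;> simp <;> omega
        · have c3 : ¬ (i = ⟨p - 2, h1⟩ ∨ i = ⟨p - 1, h2⟩) := by tauto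
          rw [if_neg c3, if_neg c1, if_neg c2]; omega
  · refine ⟨_, _, i, j, hi, hj, flip_vec _ s t i j hij, ?_⟩
    have hi2 : i ≠ ⟨p + q - 1, h⟩ := by intro h; simp [Fin.ext_iff] at h; omega
    rw [if_neg hi2]
    by_cases hj2 : j = ⟨p + q - 1, h⟩
    · have hj3 : (j : ℕ) = p + q - 1 := by rw [hj2]
      rw [if_pos hj2]
      simp only [pot]
      cases t <;> simp <;> omega
    · rw [if_neg hj2]; omega

theorem list_vec (p q : ℕ) (s t : Bool)
    (i j : Fin (p + q)) (hi : (i : ℕ) < p) (hj : p ≤ (j : ℕ)) (l : List (Aut (p + q)))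
    (hl : ∀ g ∈ l, isGenDB p q g) :
    ∃ (s' t' : Bool) (i' j' : Fin (p + q)), (i' : ℕ) < p ∧ p ≤ (j' : ℕ) ∧
      l.prod (vec s i t j) = vec s' i' t' j' ∧
      pot p q s i t j ≤ pot p q s' i' t' j' + l.length := by
  induction l with
  | nil => exact ⟨s, t, i, j, hi, hj, rfl, le_rfl⟩
  | cons g l ih =>
    obtain ⟨s1, t1, i1, j1, hi1, hj1, h1, h2⟩ := ih (fun g hg => hl g (by simp [hg]))
    obtain ⟨s2, t2, i2, j2, hi2, hj2, h3, h4⟩ :=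
      gen_vec p q g (hl g (by simp)) s1 t1 i1 j1 hi1 hj1
    refine ⟨s2, t2, i2, j2, hi2, hj2, ?_, ?_⟩
    · rw [List.prod_cons, LinearEquiv.mul_apply, h1, h3]
    · simp only [List.length_cons]; omega

theorem dom_pot (p q : ℕ) (hp : 2 ≤ p) (s t : Bool)
    (i j : Fin (p + q)) (hi : (i : ℕ) < p) (hj : p ≤ (j : ℕ))
    (h : domDB p q (vec s i t j)) : pot p q s i t j = 0 := by
  obtain ⟨d1, d2, d3, d4⟩ := h
  have hjr := j.2
  have hij : i ≠ j := by rintro rfl; omega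
  have ht : t = true := by
    have := d4 j hj
    cases t
    · simp [vec, hij.symm, sg] at this; linarith
    · rfl
  have hjp : (j : ℕ) = p := by
    by_contra hne
    have := d3 ⟨p, by omega⟩ j (by simp [Fin.le_def]; omega) (by simp)
    have e1 : (⟨p, by omega⟩ : Fin (p + q)) ≠ i := by intro h; simp [Fin.ext_iff] at h; omega
    have e2 : (⟨p, by omega⟩ : Fin (p + q)) ≠ j := by intro h; simp [Fin.ext_iff] at h; omega
    simp [vec, hij.symm, sg, e1, e2, ht] at this
    linarith
  have hip : (i : ℕ) = 0 := by
    by_contra hne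
    have e1 : (⟨0, by omega⟩ : Fin (p + q)) ≠ i := by intro h; simp [Fin.ext_iff] at h; omega
    have e2 : (⟨0, by omega⟩ : Fin (p + q)) ≠ j := by intro h; simp [Fin.ext_iff] at h; omega
    by_cases hl : (i : ℕ) + 1 < p
    · have f1 := d1 ⟨0, by omega⟩ i (by simp [Fin.le_def]) hl
      have f2 := d2 i hl (by omega)
      have f3 := (abs_nonneg _).trans f2
      cases s <;> simp [vec, sg, e1, e2] at f1 f3 <;> linarith
    · have f2 := d2 ⟨0, by omega⟩ (by simp; omega) (by omega)
      have : (⟨p - 1, by omega⟩ : Fin (p + q)) = i := by simp [Fin.ext_iff]; omega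
      rw [this] at f2
      cases s <;> simp [vec, sg, e1, e2] at f2 <;> linarith
  have hs : s = true := by
    have f2 := d2 i (by omega) (by omega)
    have f3 := (abs_nonneg _).trans f2
    cases s
    · simp [vec, sg] at f3; linarith
    · rfl
  simp [pot, hs, ht, hip, hjp]

theorem pot_dom (p q : ℕ) (hp : 2 ≤ p) (s t : Bool)
    (i j : Fin (p + q)) (hi : (i : ℕ) < p) (hj : p ≤ (j : ℕ))
    (h : pot p q s i t j = 0) : domDB p q (vec s i t j) := by
  have hjr := j.2
  unfold pot at h
  have hs : s = true := by cases s <;> simp at h ⊢; omega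
  have ht : t = true := by cases t <;> simp at h ⊢; omega
  subst hs ht
  simp at h
  have hi0 : (i : ℕ) = 0 := by omega
  have hj0 : (j : ℕ) = p := by omega
  have hn : ∀ k, 0 ≤ vec true i true j k := by
    intro k; simp only [vec, sg]; split_ifs <;> norm_num
  refine ⟨?_, ?_, ?_, fun k _ => hn k⟩
  · intro x y hxy hy
    simp only [vec, sg, Fin.ext_iff, Fin.le_def] at *
    split_ifs <;> first | omega | norm_num
  · intro x hx h
    have : vec true i true j ⟨p - 1, h⟩ = 0 := by
      simp only [vec, Fin.ext_iff]
      rw [if_neg (by omega), if_neg (by omega)]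
    rw [this, abs_zero]; exact hn x
  · intro x y hxy hy
    simp only [vec, sg, Fin.ext_iff, Fin.le_def] at *
    split_ifs <;> first | omega | norm_num

theorem descend (p q : ℕ) (hp : 2 ≤ p) (hq : 1 ≤ q) (s t : Bool)
    (i j : Fin (p + q)) (hi : (i : ℕ) < p) (hj : p ≤ (j : ℕ)) (n : ℕ)
    (h : pot p q s i t j = n + 1) :
    ∃ g, isGenDB p q g ∧ ∃ (s' t' : Bool) (i' j' : Fin (p + q)), (i' : ℕ) < p ∧ p ≤ (j' : ℕ) ∧
      g (vec s i t j) = vec s' i' t' j' ∧ pot p q s' i' t' j' = n := by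
  have hij : i ≠ j := by rintro rfl; omega
  have hjr := j.2
  have hir := i.2
  by_cases hA : s = true ∧ (i : ℕ) = 0
  · obtain ⟨rfl, hi0⟩ := hA
    by_cases ht : t = true
    · subst ht
      simp [pot, hi0] at h
      have n1 : i ≠ ⟨j - 1, by omega⟩ := by intro h; simp [Fin.ext_iff] at h; omega
      refine ⟨_, Or.inl ⟨⟨j - 1, by omega⟩, j, by simp; omega, Or.inr (by simp; omega), rfl⟩,
        true, true, i, ⟨j - 1, by omega⟩, hi, by simp; omega, ?_, ?_⟩
      · rw [swap_vec, Equiv.swap_apply_right, Equiv.swap_apply_of_ne_of_ne n1 hij]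
      · simp [pot, hi0]; omega
    · have ht : t = false := by simpa using ht
      subst ht
      simp [pot, hi0] at h
      by_cases hl : (j : ℕ) = p + q - 1
      · refine ⟨_, Or.inr (Or.inr ⟨by omega, hq, rfl⟩), true, true, i, j, hi, hj, ?_, ?_⟩
        · rw [flip_vec _ _ _ _ _ hij, if_neg (by simp [Fin.ext_iff]; omega),
            if_pos (by simp [Fin.ext_iff]; omega)]
          rfl
        · simp [pot, hi0]; omega
      · have n1 : i ≠ ⟨j + 1, by omega⟩ := by intro h; simp [Fin.ext_iff] at h; omega
        refine ⟨_, Or.inl ⟨j, ⟨j + 1, by omega⟩, by simp, Or.inr hj, rfl⟩,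
          true, false, i, ⟨j + 1, by omega⟩, hi, by simp; omega, ?_, ?_⟩
        · rw [swap_vec, Equiv.swap_apply_left, Equiv.swap_apply_of_ne_of_ne hij n1]
        · simp [pot, hi0]; omega
  · by_cases hs : s = true
    · subst hs
      simp at hA
      have n1 : j ≠ ⟨i - 1, by omega⟩ := by intro h; simp [Fin.ext_iff] at h; omega
      refine ⟨_, Or.inl ⟨⟨i - 1, by omega⟩, i, by simp; omega, Or.inl hi, rfl⟩,
        true, t, ⟨i - 1, by omega⟩, j, by simp; omega, hj, ?_, ?_⟩
      · rw [swap_vec, Equiv.swap_apply_right, Equiv.swap_apply_of_ne_of_ne n1 hij.symm]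
      · simp only [pot, if_true] at h ⊢; omega
    · have hs : s = false := by simpa using hs
      subst hs
      by_cases hl : (i : ℕ) = p - 1
      · have hi' : i = ⟨p - 1, by omega⟩ := by simp [Fin.ext_iff]; omega
        have hj1 : j ≠ ⟨p - 2, by omega⟩ := by intro h; simp [Fin.ext_iff] at h; omega
        have hj2 : j ≠ ⟨p - 1, by omega⟩ := by intro h; simp [Fin.ext_iff] at h; omega
        have h12 : (⟨p - 2, by omega⟩ : Fin (p + q)) ≠ ⟨p - 1, by omega⟩ := by
          intro h; simp [Fin.ext_iff] at h; omega
        have hsw : Equiv.swap (⟨p - 2, by omega⟩ : Fin (p + q)) ⟨p - 1, by omega⟩ i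
            = ⟨p - 2, by omega⟩ := by
          rw [Equiv.swap_apply_eq_iff, Equiv.swap_apply_left]; exact hi'
        refine ⟨_, Or.inr (Or.inl ⟨by omega, by omega, hp, rfl⟩), true, t, ⟨p - 2, by omega⟩, j,
          by simp; omega, hj, ?_, ?_⟩
        · rw [LinearEquiv.mul_apply, LinearEquiv.mul_apply, swap_vec,
            Equiv.swap_apply_of_ne_of_ne hj1 hj2, hsw,
            flip_vec _ _ _ _ _ hj1.symm, flip_vec _ _ _ _ _ hj1.symm]
          simp [hj1, hj2, h12]
        · simp [pot] at h ⊢; omega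
      · have n1 : j ≠ ⟨i + 1, by omega⟩ := by intro h; simp [Fin.ext_iff] at h; omega
        refine ⟨_, Or.inl ⟨i, ⟨i + 1, by omega⟩, by simp, Or.inl (by simp; omega), rfl⟩,
          false, t, ⟨i + 1, by omega⟩, j, by simp; omega, hj, ?_, ?_⟩
        · rw [swap_vec, Equiv.swap_apply_left, Equiv.swap_apply_of_ne_of_ne hij.symm n1]
        · simp [pot] at h ⊢; omega

theorem exists_word (p q : ℕ) (hp : 2 ≤ p) (hq : 1 ≤ q) (n : ℕ) : ∀ (s t : Bool)
    (i j : Fin (p + q)) (_ : (i : ℕ) < p) (_ : p ≤ (j : ℕ)) (_ : pot p q s i t j = n),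
    ∃ l : List (Aut (p + q)), (∀ g ∈ l, isGenDB p q g) ∧ l.length = n ∧
      domDB p q (l.prod (vec s i t j)) := by
  induction n with
  | zero =>
    intro s t i j hi hj h
    exact ⟨[], by simp, rfl, pot_dom p q hp s t i j hi hj h⟩
  | succ n ih =>
    intro s t i j hi hj h
    obtain ⟨g, hg, s', t', i', j', hi', hj', e, h'⟩ := descend p q hp hq s t i j hi hj n h
    obtain ⟨l, hl, hn, hd⟩ := ih s' t' i' j' hi' hj' h'
    refine ⟨l ++ [g], ?_, by simp [hn], ?_⟩
    · intro x hx
      rcases List.mem_append.1 hx with hx | hx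
      · exact hl x hx
      · rw [List.mem_singleton.1 hx]; exact hg
    · rw [List.prod_append, List.prod_singleton, LinearEquiv.mul_apply, e]; exact hd

theorem ind_vec (p q : ℕ) (hp : 2 ≤ p) (hq : 1 ≤ q) (s t : Bool)
    (i j : Fin (p + q)) (hi : (i : ℕ) < p) (hj : p ≤ (j : ℕ)) :
    ind (p + q) (isGenDB p q) (domDB p q) (vec s i t j) = pot p q s i t j := by
  have hmem := exists_word p q hp hq _ s t i j hi hj rfl
  apply le_antisymm
  · exact Nat.sInf_le hmem
  · refine le_csInf ⟨_, hmem⟩ ?_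
    rintro n ⟨l, hl, rfl, hd⟩
    obtain ⟨s', t', i', j', hi', hj', e, h'⟩ := list_vec p q s t i j hi hj l hl
    rw [e] at hd
    have := dom_pot p q hp s' t' i' j' hi' hj' hd
    omega

/-- In the weight lattice of `so(2r+1,ℂ)` with `r = p + q`, the index being computed in
the Weyl group of `K` with root system `D_p × B_q`: for `1 ≤ a ≤ p < b ≤ p+q`,
`ind(ε_a - ε_b) = (a-1) + (p+q-b) + q` and `ind(-ε_a + ε_b) = (b-(p+1)) + (p-a) + p - 1`. -/
theorem ind_typeDpBq (p q a b : ℕ) (hp : 2 ≤ p) (hq : 1 ≤ q)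
    (ha : 1 ≤ a) (hap : a ≤ p) (hpb : p < b) (hbr : b ≤ p + q) :
    ind (p + q) (isGenDB p q) (domDB p q)
      (eps (p + q) ⟨a - 1, by omega⟩ - eps (p + q) ⟨b - 1, by omega⟩)
      = (a - 1) + (p + q - b) + q ∧
    ind (p + q) (isGenDB p q) (domDB p q)
      (-eps (p + q) ⟨a - 1, by omega⟩ + eps (p + q) ⟨b - 1, by omega⟩)
      = (b - (p + 1)) + (p - a) + p - 1 := by
  have hne : (⟨a - 1, by omega⟩ : Fin (p + q)) ≠ ⟨b - 1, by omega⟩ := by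
    intro h; simp [Fin.ext_iff] at h; omega
  have e1 : eps (p + q) ⟨a - 1, by omega⟩ - eps (p + q) ⟨b - 1, by omega⟩
      = vec true ⟨a - 1, by omega⟩ false ⟨b - 1, by omega⟩ := by
    funext k
    simp only [eps, vec, sg, Pi.sub_apply]
    split_ifs <;> simp_all
  have e2 : -eps (p + q) ⟨a - 1, by omega⟩ + eps (p + q) ⟨b - 1, by omega⟩
      = vec false ⟨a - 1, by omega⟩ true ⟨b - 1, by omega⟩ := by
    funext k
    simp only [eps, vec, sg, Pi.add_apply, Pi.neg_apply]
    split_ifs <;> simp_all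
  constructor
  · rw [e1, ind_vec p q hp hq _ _ _ _ (by simp; omega) (by simp; omega)]
    simp [pot]; omega
  · rw [e2, ind_vec p q hp hq _ _ _ _ (by simp; omega) (by simp; omega)]
    simp [pot]; omega
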